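/- For every n ∈ ℕ there is a constant C depending only on n and d such that for all α > d, β > 0, T > 0, F ∈ Ψ_0^α and G ∈ Ψ_0^β: ‖F*G‖_{α+β,0;T,n} ≤ C · B((α−d)/2, β/2) · ‖F‖_{α,0;T,n} · ‖G‖_{β,0;T,n+d+1}, where B(a,b) = ∫_0^1 (1−s)^{a−1} s^{b−1} ds is the Beta function. The same estimate holds for families (F_w) ∈ C^0(Ψ_0^α) and (G_w) ∈ C^0(Ψ_0^β) convolved pointwise in w, with the corresponding seminorms sup_w ‖·‖. -/

import Mathlib

open MeasureTheory Filter
open scoped BigOperators ENNReal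

namespace VarBPHZ

/-! ## Basic parabolic setting on `ℝ^{1+d}` -/

/-- A space-time point in `ℝ^{1+d}`; coordinate `0` is time, coordinates `1, …, d` are space. -/
abbrev Pt (d : ℕ) := Fin (d + 1) → ℝ

variable {d : ℕ}

/-- Parabolic scaled degree `|k|_𝔰 = 2k₀ + k₁ + ⋯ + k_d` of a multi-index. -/
def pdeg (k : Fin (d + 1) → ℕ) : ℕ := k 0 + ∑ i, k i

/-- Parabolic norm `|z|_𝔰 = |t|^{1/2} + ∑ᵢ |xᵢ|`. -/
noncomputable def pnorm (z : Pt d) : ℝ := Real.sqrt |z 0| + ∑ i : Fin d, |z i.succ|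

/-- First-order partial derivative in the `i`-th coordinate. -/
noncomputable def pd (i : Fin (d + 1)) (f : Pt d → ℝ) : Pt d → ℝ :=
  fun z => fderiv ℝ f z (Pi.single i 1)

/-- Iterated partial derivative `∂^k` for a multi-index `k`. -/
noncomputable def mderiv (k : Fin (d + 1) → ℕ) (f : Pt d → ℝ) : Pt d → ℝ :=
  (List.finRange (d + 1)).foldr (fun i g => (pd i)^[k i] g) f

/-- Mixed partial derivative `∂₁^j ∂₂^m` of a two-argument kernel. -/
noncomputable def mderiv2 (j m : Fin (d + 1) → ℕ) (F : Pt d → Pt d → ℝ) :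
    Pt d → Pt d → ℝ :=
  fun z zb => mderiv j (fun z' => mderiv m (F z') zb) z

/-- Space-time convolution `u * v (z, z̄) = ∫ u(z, ζ) v(ζ, z̄) dζ`. -/
noncomputable def conv (u v : Pt d → Pt d → ℝ) : Pt d → Pt d → ℝ :=
  fun z zb => ∫ ζ : Pt d, u z ζ * v ζ zb

/-! ## The heat calculus spaces `Ψ_r^α` and `Φ_r^α` -/

/-- `Ft` is an `F̃`-representation of `F` for the space `Ψ_r^α`; the second argument of `Ft`
packs `(u, v) ∈ ℝ × ℝ^d` as an element of `ℝ^{1+d}`. -/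
def PsiRep (α : ℝ) (Ft : Pt d → Pt d → ℝ) (F : Pt d → Pt d → ℝ) : Prop :=
  ∀ z zb : Pt d, F z zb =
    if zb 0 < z 0 then
      (z 0 - zb 0) ^ ((α - d - 2) / 2) *
        Ft zb (Fin.cons (Real.sqrt (z 0 - zb 0))
          fun i : Fin d => (z i.succ - zb i.succ) / Real.sqrt (z 0 - zb 0))
    else 0

/-- Existence (and continuity) of the derivatives of `F̃` entering the `Ψ_r^α` seminorms:
derivatives are counted parabolically in the first slot and by total order in the second. -/
def PsiSmooth (r : ℕ) (Ft : Pt d → Pt d → ℝ) : Prop :=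
  (∀ j m : Fin (d + 1) → ℕ, pdeg j + ∑ i, m i < r →
    Differentiable ℝ fun p : Pt d × Pt d => mderiv2 j m Ft p.1 p.2) ∧
  ∀ j m : Fin (d + 1) → ℕ, pdeg j + ∑ i, m i ≤ r →
    Continuous fun p : Pt d × Pt d => mderiv2 j m Ft p.1 p.2

/-- The set of numbers of which the `Ψ_r^α` seminorm `‖·‖_{α,r;T,n}` of a representation
`Ft` is the supremum. -/
def psiSet (r : ℕ) (T : ℝ) (n : ℕ) (Ft : Pt d → Pt d → ℝ) : Set ℝ :=
  {y | ∃ (j m : Fin (d + 1) → ℕ) (w uv : Pt d),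
    pdeg j + ∑ i, m i ≤ r ∧ 0 ≤ uv 0 ∧ uv 0 ≤ Real.sqrt T ∧
    y = (1 + Real.sqrt (∑ i : Fin d, uv i.succ ^ 2)) ^ n * |mderiv2 j m Ft w uv|}

/-- Membership in the heat-calculus space `Ψ_r^α`. -/
def MemPsi (α : ℝ) (r : ℕ) (F : Pt d → Pt d → ℝ) : Prop :=
  ∃ Ft, PsiRep α Ft F ∧ PsiSmooth r Ft ∧
    ∀ T : ℝ, 0 < T → ∀ n : ℕ, BddAbove (psiSet r T n Ft)

/-- The `Ψ_r^α` seminorm `‖F‖_{α,r;T,n}` of a kernel `F`. -/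
noncomputable def psiNorm (α : ℝ) (r : ℕ) (T : ℝ) (n : ℕ) (F : Pt d → Pt d → ℝ) : ℝ :=
  sInf {y | ∃ Ft, PsiRep α Ft F ∧ PsiSmooth r Ft ∧ BddAbove (psiSet r T n Ft) ∧
    y = sSup (psiSet r T n Ft)}

/-- Translation invariance of a two-argument kernel. -/
def TransInv (F : Pt d → Pt d → ℝ) : Prop := ∀ z zb h : Pt d, F (z + h) (zb + h) = F z zb

/-- Membership in `Φ_r^α`, the translation-invariant part of `Ψ_r^α`. -/
def MemPhi (α : ℝ) (r : ℕ) (F : Pt d → Pt d → ℝ) : Prop := MemPsi α r F ∧ TransInv F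

/-- `∂_w^m` of a family of kernels depending on a parameter `w`. -/
noncomputable def famDeriv (m : Fin (d + 1) → ℕ) (F : Pt d → Pt d → Pt d → ℝ) :
    Pt d → Pt d → Pt d → ℝ :=
  fun w z zb => mderiv m (fun w' => F w' z zb) w

/-- Membership in `C^m(Ψ_r^α)` for a family of kernels. -/
def MemCPsi (m : ℕ) (α : ℝ) (r : ℕ) (F : Pt d → Pt d → Pt d → ℝ) : Prop :=
  (∀ m' : Fin (d + 1) → ℕ, pdeg m' < m → ∀ z zb : Pt d,
    Differentiable ℝ fun w => famDeriv m' F w z zb) ∧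
  (∀ m' : Fin (d + 1) → ℕ, pdeg m' ≤ m → ∀ w : Pt d, MemPsi α r (famDeriv m' F w)) ∧
  ∀ T : ℝ, 0 < T → ∀ n : ℕ,
    BddAbove {y | ∃ (m' : Fin (d + 1) → ℕ) (w : Pt d), pdeg m' ≤ m ∧
      y = psiNorm α r T n (famDeriv m' F w)}

/-- The `C^m(Ψ_r^α)` seminorm `sup_w max_{|m'|_𝔰 ≤ m} ‖∂_w^{m'} F_w‖_{α,r;T,n}`. -/
noncomputable def cpsiNorm (m : ℕ) (α : ℝ) (r : ℕ) (T : ℝ) (n : ℕ)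
    (F : Pt d → Pt d → Pt d → ℝ) : ℝ :=
  sSup {y | ∃ (m' : Fin (d + 1) → ℕ) (w : Pt d), pdeg m' ≤ m ∧
    y = psiNorm α r T n (famDeriv m' F w)}

/-- Membership in `C^m(Φ_r^α)`. -/
def MemCPhi (m : ℕ) (α : ℝ) (r : ℕ) (F : Pt d → Pt d → Pt d → ℝ) : Prop :=
  MemCPsi m α r F ∧ ∀ w, TransInv (F w)

/-- The Beta function `B(a,b) = ∫₀¹ (1−s)^{a−1} s^{b−1} ds`. -/
noncomputable def betaFn (a b : ℝ) : ℝ := ∫ s in (0 : ℝ)..1, (1 - s) ^ (a - 1) * s ^ (b - 1)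

/-- Euclidean norm on `ℝ^d`. -/
noncomputable def eN {d : ℕ} (v : Fin d → ℝ) : ℝ := Real.sqrt (∑ i, v i ^ 2)

lemma eN_eq (v : Fin d → ℝ) : eN v = ‖(WithLp.toLp 2 v : EuclideanSpace ℝ (Fin d))‖ := by
  simp [eN, EuclideanSpace.norm_eq]

lemma eN_nonneg (v : Fin d → ℝ) : 0 ≤ eN v := Real.sqrt_nonneg _

lemma eN_add_le (v w : Fin d → ℝ) : eN (fun i => v i + w i) ≤ eN v + eN w := by
  simp only [eN_eq]
  exact norm_add_le (WithLp.toLp 2 v : EuclideanSpace ℝ (Fin d)) (WithLp.toLp 2 w)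

lemma eN_div (v : Fin d → ℝ) {c : ℝ} (hc : 0 ≤ c) : eN (fun i => v i / c) = eN v / c := by
  simp only [eN, div_pow, ← Finset.sum_div]
  rw [Real.sqrt_div' _ (sq_nonneg c), Real.sqrt_sq hc]

lemma norm_le_eN (v : Fin d → ℝ) : ‖v‖ ≤ eN v := by
  rw [pi_norm_le_iff_of_nonneg (eN_nonneg v)]
  intro i
  rw [Real.norm_eq_abs]
  apply Real.abs_le_sqrt
  exact Finset.single_le_sum (f := fun i => v i ^ 2) (fun i _ => sq_nonneg _) (Finset.mem_univ i)

lemma foldr_id (L : List (Fin (d + 1))) (f : Pt d → ℝ) :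
    L.foldr (fun i g => (pd i)^[(0 : Fin (d + 1) → ℕ) i] g) f = f := by
  induction L with
  | nil => rfl
  | cons a L ih => simpa using ih

lemma mderiv_zero (f : Pt d → ℝ) : mderiv (0 : Fin (d + 1) → ℕ) f = f := foldr_id _ f

lemma mderiv2_zero (F : Pt d → Pt d → ℝ) : mderiv2 0 0 F = F := by
  funext z zb
  simp [mderiv2, mderiv_zero]

lemma pdeg_zero_of {j : Fin (d + 1) → ℕ} (h : pdeg j ≤ 0) : j = 0 := by
  unfold pdeg at h
  have h2 : ∑ i, j i = 0 := by omega
  funext i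
  exact (Finset.sum_eq_zero_iff.1 h2) i (Finset.mem_univ i)

lemma famDeriv_zero (F : Pt d → Pt d → Pt d → ℝ) : famDeriv 0 F = F := by
  funext w z zb
  simp [famDeriv, mderiv_zero]

lemma mem_psiSet_zero {T : ℝ} {n : ℕ} {Ft : Pt d → Pt d → ℝ} {y : ℝ} :
    y ∈ psiSet 0 T n Ft ↔ ∃ w uv : Pt d, 0 ≤ uv 0 ∧ uv 0 ≤ Real.sqrt T ∧
      y = (1 + eN (fun i : Fin d => uv i.succ)) ^ n * |Ft w uv| := by
  constructor
  · rintro ⟨j, m, w, uv, h, h0, h1, rfl⟩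
    have hj : j = 0 := pdeg_zero_of (by omega)
    have hm : m = 0 := by
      have h2 : ∑ i, m i = 0 := by omega
      funext i
      exact (Finset.sum_eq_zero_iff.1 h2) i (Finset.mem_univ i)
    subst hj hm
    exact ⟨w, uv, h0, h1, by rw [mderiv2_zero]; rfl⟩
  · rintro ⟨w, uv, h0, h1, rfl⟩
    exact ⟨0, 0, w, uv, by simp [pdeg], h0, h1, by rw [mderiv2_zero]; rfl⟩

lemma sSup_psiSet_nonneg {T : ℝ} {n : ℕ} {Ft : Pt d → Pt d → ℝ} : 0 ≤ sSup (psiSet 0 T n Ft) := by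
  apply Real.sSup_nonneg
  intro y hy
  obtain ⟨w, uv, -, -, rfl⟩ := mem_psiSet_zero.1 hy
  have := eN_nonneg (fun i : Fin d => uv i.succ)
  positivity

lemma psiNorm_nonneg (α : ℝ) (T : ℝ) (n : ℕ) (F : Pt d → Pt d → ℝ) : 0 ≤ psiNorm α 0 T n F := by
  apply Real.sInf_nonneg
  rintro y ⟨Ft, -, -, -, rfl⟩
  exact sSup_psiSet_nonneg

lemma psi_pointwise {α T : ℝ} (hT : 0 < T) (n : ℕ) {F : Pt d → Pt d → ℝ} (hF : MemPsi α 0 F)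
    (z zb : Pt d) (h : zb 0 < z 0) (hle : z 0 - zb 0 ≤ T) :
    (1 + eN (fun i : Fin d => (z i.succ - zb i.succ)) / Real.sqrt (z 0 - zb 0)) ^ n * |F z zb| ≤
      (z 0 - zb 0) ^ ((α - d - 2) / 2) * psiNorm α 0 T n F := by
  have hpos : 0 < z 0 - zb 0 := by linarith
  have hp : 0 < (z 0 - zb 0) ^ ((α - d - 2) / 2) := Real.rpow_pos_of_pos hpos _
  rw [← div_le_iff₀' hp]
  apply le_csInf
  · obtain ⟨Ft, h1, h2, h3⟩ := hF
    exact ⟨_, Ft, h1, h2, h3 T hT n, rfl⟩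
  · rintro y ⟨Ft, h1, h2, h3, rfl⟩
    apply le_csSup h3
    rw [mem_psiSet_zero]
    refine ⟨zb, Fin.cons (Real.sqrt (z 0 - zb 0))
          fun i : Fin d => (z i.succ - zb i.succ) / Real.sqrt (z 0 - zb 0), ?_, ?_, ?_⟩
    · simp
    · simpa using Real.sqrt_le_sqrt hle
    · rw [h1 z zb, if_pos h, abs_mul, abs_of_pos hp]
      simp only [Fin.cons_succ]
      rw [eN_div _ (Real.sqrt_nonneg _)]
      field_simp

lemma beta_ii {a b : ℝ} (ha : 0 < a) (hb : 0 < b) :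
    IntervalIntegrable (fun s : ℝ => (1 - s) ^ (a - 1) * s ^ (b - 1)) volume 0 1 := by
  have h := (Complex.betaIntegral_convergent (u := b) (v := a) (by simpa) (by simpa)).norm
  refine h.congr_ae ?_
  rw [Set.uIoc_of_le zero_le_one]
  have h1 : ∀ᵐ s : ℝ, s ≠ 1 := by simp [ae_iff]
  filter_upwards [ae_restrict_mem measurableSet_Ioc, ae_restrict_of_ae h1] with s hs hs1
  have hlt : s < 1 := lt_of_le_of_ne hs.2 hs1
  have e1 : ‖((s : ℂ)) ^ ((b : ℂ) - 1)‖ = s ^ (b - 1) := by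
    rw [Complex.norm_cpow_eq_rpow_re_of_pos hs.1]; simp
  have e2 : ‖(1 - (s : ℂ)) ^ ((a : ℂ) - 1)‖ = (1 - s) ^ (a - 1) := by
    have : (1 - (s : ℂ)) = ((1 - s : ℝ) : ℂ) := by push_cast; rfl
    rw [this, Complex.norm_cpow_eq_rpow_re_of_pos (by linarith)]; simp
  rw [norm_mul, e1, e2, mul_comm]

lemma betaFn_nonneg (a b : ℝ) : 0 ≤ betaFn a b := by
  apply intervalIntegral.integral_nonneg zero_le_one
  intro s hs
  exact mul_nonneg (Real.rpow_nonneg (by linarith [hs.2]) _) (Real.rpow_nonneg hs.1 _)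

lemma beta_lint {a b p q : ℝ} (ha : 0 < a) (hb : 0 < b) (hpq : p < q) :
    ∫⁻ s in Set.Ioo p q, ENNReal.ofReal ((q - s) ^ (a - 1) * (s - p) ^ (b - 1)) =
      ENNReal.ofReal ((q - p) ^ (a + b - 1) * betaFn a b) := by
  have hL : 0 < q - p := by linarith
  have hLn : q - p ≠ 0 := hL.ne'
  set f : ℝ → ℝ := fun s => (1 - s) ^ (a - 1) * s ^ (b - 1) with hf
  have key : ∀ s ∈ Set.Ioo p q, (q - s) ^ (a - 1) * (s - p) ^ (b - 1) =
      (q - p) ^ (a + b - 2) * f ((q - p)⁻¹ * (s - p)) := by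
    intro s hs
    have e1 : 1 - (q - p)⁻¹ * (s - p) = (q - s) / (q - p) := by field_simp; ring
    have e2 : (q - p)⁻¹ * (s - p) = (s - p) / (q - p) := by field_simp
    have hs1 : 0 < q - s := by linarith [hs.2]
    have hs2 : 0 < s - p := by linarith [hs.1]
    simp only [hf]
    rw [e1, e2, Real.div_rpow hs1.le hL.le, Real.div_rpow hs2.le hL.le,
      show a + b - 2 = (a - 1) + (b - 1) by ring, Real.rpow_add hL]
    have h1 := (Real.rpow_pos_of_pos hL (a - 1)).ne'
    have h2 := (Real.rpow_pos_of_pos hL (b - 1)).ne'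
    field_simp
  rw [setLIntegral_congr_fun measurableSet_Ioo (fun s hs => by rw [key s hs])]
  have hii : IntervalIntegrable (fun s => f ((q - p)⁻¹ * (s - p))) volume p q := by
    have h1 := ((beta_ii ha hb).comp_mul_left (c := (q - p)⁻¹)).comp_sub_right p
    simpa using h1
  have hio : IntegrableOn (fun s => (q - p) ^ (a + b - 2) * f ((q - p)⁻¹ * (s - p)))
      (Set.Ioo p q) volume :=
    (((intervalIntegrable_iff_integrableOn_Ioo_of_le hpq.le).1 hii)).const_mul _
  rw [← ofReal_integral_eq_lintegral_ofReal hio]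
  · congr 1
    rw [integral_const_mul, ← integral_Ioc_eq_integral_Ioo,
      ← intervalIntegral.integral_of_le hpq.le]
    have := intervalIntegral.integral_comp_sub_right (a := p) (b := q)
      (fun s => f ((q - p)⁻¹ * s)) p
    rw [this, intervalIntegral.integral_comp_mul_left f (inv_ne_zero hLn)]
    simp only [sub_self, mul_zero, inv_mul_cancel₀ hLn, inv_inv, smul_eq_mul]
    rw [show a + b - 1 = (a + b - 2) + 1 by ring, Real.rpow_add_one hLn]
    simp only [betaFn, hf]
    ring
  · filter_upwards [ae_restrict_mem measurableSet_Ioo] with s hs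
    rw [← key s hs]
    exact mul_nonneg (Real.rpow_nonneg (by linarith [hs.2]) _)
      (Real.rpow_nonneg (by linarith [hs.1]) _)

/-- The spatial constant. -/
noncomputable def spC (d : ℕ) : ℝ := ∫ y : Fin d → ℝ, (1 + ‖y‖) ^ (-((d : ℝ) + 1))

lemma spC_nonneg (d : ℕ) : 0 ≤ spC d :=
  integral_nonneg (fun y => Real.rpow_nonneg (by positivity) _)

lemma space_lint (x : Fin d → ℝ) {R : ℝ} (hR : 0 < R) :
    ∫⁻ y : Fin d → ℝ, ENNReal.ofReal ((1 + ‖y - x‖ / R) ^ (-((d : ℝ) + 1))) =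
      ENNReal.ofReal (R ^ d * spC d) := by
  have e : ∀ y : Fin d → ℝ, ‖y‖ / R = ‖R⁻¹ • y‖ := by
    intro y
    rw [norm_smul, Real.norm_of_nonneg (inv_nonneg.2 hR.le)]; ring
  rw [lintegral_sub_right_eq_self
    (fun y : Fin d → ℝ => ENNReal.ofReal ((1 + ‖y‖ / R) ^ (-((d : ℝ) + 1)))) x]
  simp_rw [e]
  have hi : Integrable (fun y : Fin d → ℝ => (1 + ‖y‖) ^ (-((d : ℝ) + 1))) volume :=
    integrable_one_add_norm (by simp)
  rw [← ofReal_integral_eq_lintegral_ofReal (hi.comp_smul (inv_ne_zero hR.ne'))]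
  · rw [Measure.integral_comp_inv_smul_of_nonneg volume
      (fun y : Fin d → ℝ => (1 + ‖y‖) ^ (-((d : ℝ) + 1))) hR.le]
    simp [spC]
  · exact Filter.Eventually.of_forall (fun y => Real.rpow_nonneg (by positivity) _)

/-- The pointwise bound of the integrand. -/
lemma integrand_bound {α β T : ℝ} (hT : 0 < T) (n : ℕ)
    {F G : Pt d → Pt d → ℝ} (hF : MemPsi α 0 F) (hG : MemPsi β 0 G)
    (z zb : Pt d) (hle : z 0 - zb 0 ≤ T) (ζ : Pt d) (h1 : zb 0 < ζ 0) (h2 : ζ 0 < z 0) :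
    (1 + eN (fun i : Fin d => (z i.succ - zb i.succ)) / Real.sqrt (z 0 - zb 0)) ^ n *
        |F z ζ * G ζ zb| ≤
      psiNorm α 0 T n F * psiNorm β 0 T (n + d + 1) G *
      ((z 0 - ζ 0) ^ ((α - d - 2) / 2) * (ζ 0 - zb 0) ^ ((β - d - 2) / 2)) *
        (1 + ‖(fun i : Fin d => ζ i.succ) - (fun i : Fin d => zb i.succ)‖ /
          Real.sqrt (ζ 0 - zb 0)) ^ (-((d : ℝ) + 1)) := by
  have hA := psi_pointwise hT n hF z ζ h2 (by linarith)
  have hB := psi_pointwise hT (n + d + 1) hG ζ zb h1 (by linarith)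
  set NF := psiNorm α 0 T n F
  set NG := psiNorm β 0 T (n + d + 1) G
  set a := eN (fun i : Fin d => (z i.succ - ζ i.succ)) with ha
  set b := eN (fun i : Fin d => (ζ i.succ - zb i.succ)) with hb
  set c := eN (fun i : Fin d => (z i.succ - zb i.succ)) with hc
  set m := ‖(fun i : Fin d => ζ i.succ) - (fun i : Fin d => zb i.succ)‖ with hm
  have ha0 : 0 ≤ a := eN_nonneg _
  have hb0 : 0 ≤ b := eN_nonneg _
  have hc0 : 0 ≤ c := eN_nonneg _
  have hm0 : 0 ≤ m := norm_nonneg _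
  have hmb : m ≤ b := norm_le_eN _
  have hcab : c ≤ a + b := by
    have := eN_add_le (fun i : Fin d => (z i.succ - ζ i.succ)) (fun i => (ζ i.succ - zb i.succ))
    simpa using this
  set ra := Real.sqrt (z 0 - ζ 0)
  set rb := Real.sqrt (ζ 0 - zb 0)
  set rc := Real.sqrt (z 0 - zb 0)
  have hra : 0 < ra := Real.sqrt_pos.2 (by linarith)
  have hrb : 0 < rb := Real.sqrt_pos.2 (by linarith)
  have hrc : 0 < rc := Real.sqrt_pos.2 (by linarith)
  have hrac : ra ≤ rc := Real.sqrt_le_sqrt (by linarith)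
  have hrbc : rb ≤ rc := Real.sqrt_le_sqrt (by linarith)
  have hw : 1 + c / rc ≤ (1 + a / ra) * (1 + b / rb) := by
    have h3 : a / rc ≤ a / ra := div_le_div_of_nonneg_left ha0 hra hrac
    have h4 : b / rc ≤ b / rb := div_le_div_of_nonneg_left hb0 hrb hrbc
    have h5 : c / rc ≤ a / rc + b / rc := by rw [← add_div]; gcongr
    have h6 : 0 ≤ (a / ra) * (b / rb) := by positivity
    nlinarith
  have hwn : (1 + c / rc) ^ n ≤ (1 + a / ra) ^ n * (1 + b / rb) ^ n := by
    rw [← mul_pow]; gcongr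
  have hrp : (1 + m / rb) ^ (-((d : ℝ) + 1)) = ((1 + m / rb) ^ (d + 1))⁻¹ := by
    rw [Real.rpow_neg (by positivity), ← Real.rpow_natCast]; push_cast; rfl
  have hpm : 0 < (1 + m / rb) ^ (d + 1) := by positivity
  have hmb' : (1 + m / rb) ^ (d + 1) ≤ (1 + b / rb) ^ (d + 1) := by gcongr
  rw [hrp, ← div_eq_mul_inv, le_div_iff₀ hpm, abs_mul]
  have hprod := mul_le_mul hA hB (by positivity) (le_trans (by positivity) hA)
  calc (1 + c / rc) ^ n * (|F z ζ| * |G ζ zb|) * (1 + m / rb) ^ (d + 1)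
      ≤ ((1 + a / ra) ^ n * (1 + b / rb) ^ n) * (|F z ζ| * |G ζ zb|) *
          (1 + b / rb) ^ (d + 1) := by gcongr
    _ = (1 + a / ra) ^ n * |F z ζ| * ((1 + b / rb) ^ (n + d + 1) * |G ζ zb|) := by
        rw [add_assoc n d 1, pow_add (1 + b / rb) n (d + 1)]; ring
    _ ≤ _ := hprod
    _ = _ := by ring

/-- Splitting off the time variable in a nonnegative integral. -/
lemma lintegral_split (g : ℝ × (Fin d → ℝ) → ℝ≥0∞) :
    ∫⁻ ζ : Pt d, g (ζ 0, fun i => ζ i.succ) = ∫⁻ p : ℝ × (Fin d → ℝ), g p := by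
  have h := (volume_preserving_piFinSuccAbove (fun _ : Fin (d + 1) => ℝ) 0).lintegral_comp_emb
    (MeasurableEquiv.measurableEmbedding _) g
  rw [← h]
  rfl

lemma conv_bound {α β T : ℝ} (hα : (d : ℝ) < α) (hβ : 0 < β) (hT : 0 < T) (n : ℕ)
    {F G : Pt d → Pt d → ℝ} (hF : MemPsi α 0 F) (hG : MemPsi β 0 G)
    (z zb : Pt d) (h : zb 0 < z 0) (hle : z 0 - zb 0 ≤ T) :
    (1 + eN (fun i : Fin d => (z i.succ - zb i.succ)) / Real.sqrt (z 0 - zb 0)) ^ n *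
        |conv F G z zb| ≤
      (z 0 - zb 0) ^ ((α + β - d - 2) / 2) *
       (spC d * betaFn ((α - d) / 2) (β / 2) * psiNorm α 0 T n F *
          psiNorm β 0 T (n + d + 1) G) := by
  have hIB := integrand_bound hT n hF hG z zb hle
  have hNF := psiNorm_nonneg α T n F
  have hNG := psiNorm_nonneg β T (n + d + 1) G
  have hF0 : ∀ z ζ : Pt d, ¬ (ζ 0 < z 0) → F z ζ = 0 := by
    obtain ⟨Ft, h1, -⟩ := hF
    intro z ζ hh
    rw [h1 z ζ, if_neg hh]
  have hG0 : ∀ z ζ : Pt d, ¬ (ζ 0 < z 0) → G z ζ = 0 := by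
    obtain ⟨Ft, h1, -⟩ := hG
    intro z ζ hh
    rw [h1 z ζ, if_neg hh]
  set NF := psiNorm α 0 T n F
  set NG := psiNorm β 0 T (n + d + 1) G
  set W := (1 + eN (fun i : Fin d => (z i.succ - zb i.succ)) / Real.sqrt (z 0 - zb 0)) ^ n with hW
  have hW0 : 0 ≤ W := by
    have := eN_nonneg (fun i : Fin d => (z i.succ - zb i.succ))
    positivity
  have hpos : 0 < z 0 - zb 0 := by linarith
  have hB0 := betaFn_nonneg ((α - d) / 2) (β / 2)
  have hC0 := spC_nonneg d
  have hR0 : 0 ≤ (z 0 - zb 0) ^ ((α + β - d - 2) / 2) *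
       (spC d * betaFn ((α - d) / 2) (β / 2) * NF * NG) := by positivity
  let A : ℝ → ℝ := fun s => NF * NG * ((z 0 - s) ^ ((α - d - 2) / 2) *
      (s - zb 0) ^ ((β - d - 2) / 2))
  let S : ℝ → (Fin d → ℝ) → ℝ := fun s y =>
    (1 + ‖y - (fun i : Fin d => zb i.succ)‖ / Real.sqrt (s - zb 0)) ^ (-((d : ℝ) + 1))
  let g : ℝ × (Fin d → ℝ) → ℝ≥0∞ := fun p =>
    (Set.Ioo (zb 0) (z 0)).indicator (fun s => ENNReal.ofReal (A s)) p.1 * ENNReal.ofReal (S p.1 p.2)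
  have hAm : Measurable A := by fun_prop
  have hSm : Measurable (fun p : ℝ × (Fin d → ℝ) => S p.1 p.2) := by fun_prop
  have hgm : Measurable g := by
    apply Measurable.mul
    · exact ((hAm.ennreal_ofReal).indicator measurableSet_Ioo).comp measurable_fst
    · exact hSm.ennreal_ofReal
  have hA0 : ∀ s ∈ Set.Ioo (zb 0) (z 0), 0 ≤ A s := by
    intro s hs
    have h1 := Real.rpow_nonneg (show 0 ≤ z 0 - s by linarith [hs.2]) ((α - d - 2) / 2)
    have h2 := Real.rpow_nonneg (show 0 ≤ s - zb 0 by linarith [hs.1]) ((β - d - 2) / 2)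
    positivity
  have hbound : ∀ ζ : Pt d, ‖W * (F z ζ * G ζ zb)‖ₑ ≤ g (ζ 0, fun i => ζ i.succ) := by
    intro ζ
    by_cases hζ : ζ 0 ∈ Set.Ioo (zb 0) (z 0)
    · have := hIB ζ hζ.1 hζ.2
      simp only [g, Set.indicator_of_mem hζ]
      rw [← ENNReal.ofReal_mul (hA0 _ hζ), ← ofReal_norm_eq_enorm, norm_mul,
        Real.norm_of_nonneg hW0, Real.norm_eq_abs]
      exact ENNReal.ofReal_le_ofReal this
    · have : F z ζ * G ζ zb = 0 := by
        by_cases h1 : ζ 0 < z 0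
        · have h2 : ¬ (zb 0 < ζ 0) := fun h2 => hζ ⟨h2, h1⟩
          rw [hG0 _ _ h2, mul_zero]
        · rw [hF0 _ _ h1, zero_mul]
      simp [this]
  have hint : ∫⁻ p, g p = ENNReal.ofReal ((z 0 - zb 0) ^ ((α + β - d - 2) / 2) *
       (spC d * betaFn ((α - d) / 2) (β / 2) * NF * NG)) := by
    rw [Measure.volume_eq_prod, lintegral_prod _ hgm.aemeasurable]
    have hin : ∀ s, ∫⁻ y, g (s, y) = (Set.Ioo (zb 0) (z 0)).indicator
        (fun s => ENNReal.ofReal (spC d * NF * NG) *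
          ENNReal.ofReal ((z 0 - s) ^ ((α - d) / 2 - 1) * (s - zb 0) ^ (β / 2 - 1))) s := by
      intro s
      by_cases hs : s ∈ Set.Ioo (zb 0) (z 0)
      · have hs1 : 0 < s - zb 0 := by linarith [hs.1]
        have hs2 : 0 < z 0 - s := by linarith [hs.2]
        simp only [g, Set.indicator_of_mem hs, S]
        rw [lintegral_const_mul' _ _ ENNReal.ofReal_ne_top, space_lint _ (Real.sqrt_pos.2 hs1),
          ← ENNReal.ofReal_mul (hA0 s hs), ← ENNReal.ofReal_mul (by positivity)]
        congr 1
        simp only [A]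
        have e1 : Real.sqrt (s - zb 0) ^ d = (s - zb 0) ^ ((d : ℝ) / 2) := by
          rw [Real.sqrt_eq_rpow, ← Real.rpow_natCast, ← Real.rpow_mul hs1.le]
          congr 1; ring
        have e2 : (s - zb 0) ^ (β / 2 - 1) =
            (s - zb 0) ^ ((β - d - 2) / 2) * (s - zb 0) ^ ((d : ℝ) / 2) := by
          rw [← Real.rpow_add hs1]; congr 1; ring
        rw [e1, e2, show (α - d) / 2 - 1 = (α - d - 2) / 2 by ring]
        ring
      · simp [g, Set.indicator_of_notMem hs]
    simp_rw [hin]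
    rw [lintegral_indicator measurableSet_Ioo, lintegral_const_mul' _ _ ENNReal.ofReal_ne_top,
      beta_lint (by linarith) (by linarith) h, ← ENNReal.ofReal_mul (by positivity)]
    congr 1
    rw [show (α - d) / 2 + β / 2 - 1 = (α + β - d - 2) / 2 by ring]
    ring
  have hfin : ‖∫ ζ : Pt d, W * (F z ζ * G ζ zb)‖ₑ ≤ ENNReal.ofReal
      ((z 0 - zb 0) ^ ((α + β - d - 2) / 2) *
       (spC d * betaFn ((α - d) / 2) (β / 2) * NF * NG)) := by
    calc _ ≤ ∫⁻ ζ : Pt d, ‖W * (F z ζ * G ζ zb)‖ₑ := enorm_integral_le_lintegral_enorm _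
      _ ≤ ∫⁻ ζ : Pt d, g (ζ 0, fun i => ζ i.succ) := lintegral_mono hbound
      _ = _ := by rw [lintegral_split, hint]
  rw [integral_const_mul, ← ofReal_norm_eq_enorm, ENNReal.ofReal_le_ofReal_iff hR0, norm_mul,
    Real.norm_of_nonneg hW0, Real.norm_eq_abs] at hfin
  exact hfin

lemma psiNorm_conv_le {α β T : ℝ} (hα : (d : ℝ) < α) (hβ : 0 < β) (hT : 0 < T) (n : ℕ)
    {F G : Pt d → Pt d → ℝ} (hF : MemPsi α 0 F) (hG : MemPsi β 0 G) :
    psiNorm (α + β) 0 T n (conv F G) ≤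
       spC d * betaFn ((α - d) / 2) (β / 2) * psiNorm α 0 T n F *
          psiNorm β 0 T (n + d + 1) G := by
  have hcb := conv_bound hα hβ hT n hF hG
  have hNF := psiNorm_nonneg α T n F
  have hNG := psiNorm_nonneg β T (n + d + 1) G
  have hB0 := betaFn_nonneg ((α - d) / 2) (β / 2)
  have hC0 := spC_nonneg d
  have hK : 0 ≤ spC d * betaFn ((α - d) / 2) (β / 2) * psiNorm α 0 T n F *
          psiNorm β 0 T (n + d + 1) G := by positivity
  set K := spC d * betaFn ((α - d) / 2) (β / 2) * psiNorm α 0 T n F *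
          psiNorm β 0 T (n + d + 1) G
  by_cases hne : {y | ∃ Ft, PsiRep (α + β) Ft (conv F G) ∧ PsiSmooth 0 Ft ∧
      BddAbove (psiSet 0 T n Ft) ∧ y = sSup (psiSet 0 T n Ft)}.Nonempty
  swap
  · rw [Set.not_nonempty_iff_eq_empty] at hne
    unfold psiNorm
    rw [hne, Real.sInf_empty]
    exact hK
  obtain ⟨y, Ft, h1, h2, h3, rfl⟩ := hne
  have hle : psiNorm (α + β) 0 T n (conv F G) ≤ sSup (psiSet 0 T n Ft) := by
    apply csInf_le
    · refine ⟨0, ?_⟩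
      rintro y ⟨Ft, -, -, -, rfl⟩
      exact sSup_psiSet_nonneg
    · exact ⟨Ft, h1, h2, h3, rfl⟩
  refine hle.trans ?_
  apply Real.sSup_le _ hK
  intro y hy
  obtain ⟨w, uv, hu0, hu1, rfl⟩ := mem_psiSet_zero.1 hy
  have hcont : Continuous fun p : Pt d × Pt d => Ft p.1 p.2 := by
    have := h2.2 0 0 (by simp [pdeg])
    rwa [mderiv2_zero] at this
  -- the estimate for positive `u`
  have hposu : ∀ (u : ℝ) (v : Fin d → ℝ), 0 < u → u ≤ Real.sqrt T →
      (1 + eN v) ^ n * |Ft w (Fin.cons u v)| ≤ K := by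
    intro u v hu huT
    let z : Pt d := Fin.cons (w 0 + u ^ 2) (fun i => w i.succ + u * v i)
    have hz0 : z 0 = w 0 + u ^ 2 := rfl
    have hzs : ∀ i : Fin d, z i.succ = w i.succ + u * v i := fun i => rfl
    have hd0 : z 0 - w 0 = u ^ 2 := by rw [hz0]; ring
    have hlt : w 0 < z 0 := by rw [hz0]; have := pow_pos hu 2; linarith
    have huT2 : u ^ 2 ≤ T := by
      have := pow_le_pow_left₀ hu.le huT 2
      rwa [Real.sq_sqrt hT.le] at this
    have hb := hcb z w hlt (by rw [hd0]; exact huT2)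
    have hvv : (fun i : Fin d => (z i.succ - w i.succ) / u) = v := by
      funext i
      rw [hzs]; field_simp; ring
    have hp : 0 < (u ^ 2) ^ ((α + β - d - 2) / 2) := Real.rpow_pos_of_pos (pow_pos hu 2) _
    rw [h1 z w, if_pos hlt, hd0, Real.sqrt_sq hu.le, ← eN_div _ hu.le, hvv, abs_mul,
      abs_of_pos hp] at hb
    refine le_of_mul_le_mul_left ?_ hp
    calc _ = _ := by ring
      _ ≤ _ := hb
  have huv : uv = Fin.cons (uv 0) (fun i : Fin d => uv i.succ) := (Fin.cons_self_tail uv).symm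
  rcases hu0.lt_or_eq with hlt | heq
  · have := hposu (uv 0) (fun i => uv i.succ) hlt hu1
    rwa [← huv] at this
  · have hsT : 0 < Real.sqrt T := Real.sqrt_pos.2 hT
    have hcu : Continuous fun u : ℝ => (1 + eN (fun i : Fin d => uv i.succ)) ^ n *
        |Ft w (Fin.cons u (fun i : Fin d => uv i.succ))| := by
      have hc1 : Continuous fun u : ℝ => (Fin.cons u (fun i : Fin d => uv i.succ) : Pt d) := by
        apply continuous_pi
        intro i
        refine Fin.cases ?_ (fun j => ?_) i
        · exact continuous_id
        · simpa using continuous_const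
      have hc2 : Continuous fun u : ℝ => Ft w (Fin.cons u (fun i : Fin d => uv i.succ) : Pt d) :=
        hcont.comp (continuous_const.prodMk hc1)
      exact continuous_const.mul hc2.abs
    have ht := (hcu.tendsto 0).mono_left (nhdsWithin_le_nhds (s := Set.Ioi 0))
    have := le_of_tendsto ht (b := K) (by
      filter_upwards [Ioc_mem_nhdsGT hsT] with u hu
      exact hposu u _ hu.1 hu.2)
    rw [heq, ← huv] at this
    exact this

/-- Beta-function convolution estimate.
For every `n ∈ ℕ` there is `C > 0` depending only on `n` and `d` such that for all
`α > d`, `β > 0`, `T > 0`, `F ∈ Ψ_0^α` and `G ∈ Ψ_0^β`,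
`‖F*G‖_{α+β,0;T,n} ≤ C · B((α−d)/2, β/2) · ‖F‖_{α,0;T,n} · ‖G‖_{β,0;T,n+d+1}`,
and the same estimate holds for families in `C^0(Ψ_0^α)`, `C^0(Ψ_0^β)` convolved
pointwise in the parameter. -/
theorem psi_conv_beta_estimate (d : ℕ) (hd : 1 ≤ d) (n : ℕ) :
    ∃ C : ℝ, 0 < C ∧
      (∀ α β T : ℝ, (d : ℝ) < α → 0 < β → 0 < T →
        ∀ F G : Pt d → Pt d → ℝ, MemPsi α 0 F → MemPsi β 0 G →
          psiNorm (α + β) 0 T n (conv F G) ≤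
            C * betaFn ((α - d) / 2) (β / 2) * psiNorm α 0 T n F *
              psiNorm β 0 T (n + d + 1) G) ∧
      ∀ α β T : ℝ, (d : ℝ) < α → 0 < β → 0 < T →
        ∀ F G : Pt d → Pt d → Pt d → ℝ, MemCPsi 0 α 0 F → MemCPsi 0 β 0 G →
          cpsiNorm 0 (α + β) 0 T n (fun w => conv (F w) (G w)) ≤
            C * betaFn ((α - d) / 2) (β / 2) * cpsiNorm 0 α 0 T n F *
              cpsiNorm 0 β 0 T (n + d + 1) G := by
  have hC0 := spC_nonneg d
  have hmono : ∀ {a b NF NG : ℝ}, 0 ≤ NF → 0 ≤ NG →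
      spC d * betaFn a b * NF * NG ≤ (spC d + 1) * betaFn a b * NF * NG := by
    intro a b NF NG h1 h2
    have := betaFn_nonneg a b
    gcongr
    linarith
  refine ⟨spC d + 1, by linarith, ?_, ?_⟩
  · intro α β T hα hβ hT F G hF hG
    exact (psiNorm_conv_le hα hβ hT n hF hG).trans
      (hmono (psiNorm_nonneg _ _ _ _) (psiNorm_nonneg _ _ _ _))
  · intro α β T hα hβ hT F G hF hG
    have hle : ∀ {γ : ℝ} {k : ℕ} {H : Pt d → Pt d → Pt d → ℝ}, MemCPsi 0 γ 0 H → ∀ w,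
        psiNorm γ 0 T k (H w) ≤ cpsiNorm 0 γ 0 T k H := by
      intro γ k H hH w
      exact le_csSup (hH.2.2 T hT k) ⟨0, w, by simp [pdeg], by rw [famDeriv_zero]⟩
    have hmem : ∀ {γ : ℝ} {H : Pt d → Pt d → Pt d → ℝ}, MemCPsi 0 γ 0 H → ∀ w,
        MemPsi γ 0 (H w) := by
      intro γ H hH w
      have := hH.2.1 0 (by simp [pdeg]) w
      rwa [famDeriv_zero] at this
    apply csSup_le
    · exact ⟨_, 0, 0, by simp [pdeg], rfl⟩
    · rintro y ⟨m', w, hm', rfl⟩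
      rw [pdeg_zero_of hm', famDeriv_zero]
      have h0 := psiNorm_nonneg α T n (F w)
      have h1 := psiNorm_nonneg β T (n + d + 1) (G w)
      have h2 := betaFn_nonneg ((α - d) / 2) (β / 2)
      refine (psiNorm_conv_le hα hβ hT n (hmem hF w) (hmem hG w)).trans ((hmono h0 h1).trans ?_)
      have h3 := hle (k := n) hF w
      have h4 := hle (k := n + d + 1) hG w
      have h5 := h0.trans h3
      gcongr

end VarBPHZ
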